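/- arXiv:2107.12105 — 3 statements merged into one kernel-verified Lean document; each statement's English description precedes it below -/
import Mathlib

section
/- Let K be a field, V a K-vector space, and f a linear endomorphism of V whose generalized eigenspaces span V (i.e. the supremum over α ∈ K of the generalized eigenspaces of f equals V). Let S be a linear endomorphism of V such that S v = α • v for every α ∈ K and every v in the generalized eigenspace of f for α. Then for every linear endomorphism g of V and every c ∈ K with f ∘ g − g ∘ f = c • g, the operator f − S commutes with g: (f − S) ∘ g = g ∘ (f − S). -/
/-- The generalized eigenspace of `f` for eigenvalue `α`:
`{v | (f - α • id)^N v = 0 for some N}`. -/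
def genEigSet {K V : Type*} [Field K] [AddCommGroup V] [Module K V]
    (f : Module.End K V) (α : K) : Set V :=
  {v | ∃ N : ℕ, ((f - α • (1 : Module.End K V)) ^ N) v = 0}

theorem map_mem_genEigSet_add {K V : Type*} [Field K] [AddCommGroup V] [Module K V]
    {f g : Module.End K V} {c : K} (h : f * g - g * f = c • g) {α : K} {v : V}
    (hv : v ∈ genEigSet f α) : g v ∈ genEigSet f (α + c) := by
  obtain ⟨N, hN⟩ := hv
  have hsemi : SemiconjBy g (f - α • (1 : Module.End K V))
      (f - (α + c) • (1 : Module.End K V)) := by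
    rw [SemiconjBy, mul_sub, sub_mul, add_smul, add_mul, smul_mul_assoc, smul_mul_assoc,
      mul_smul_comm, one_mul, mul_one, ← h]
    abel
  refine ⟨N, ?_⟩
  rw [← Module.End.mul_apply, ← (hsemi.pow_right N).eq, Module.End.mul_apply, hN, map_zero]

/-- If the generalized eigenspaces of `f` span `V`, and `S` acts as the scalar `α`
on the generalized eigenspace of `f` for `α`, then `f - S` commutes with any `g`
satisfying `f ∘ g - g ∘ f = c • g`. -/
theorem stmt_2 {K V : Type*} [Field K] [AddCommGroup V] [Module K V]
    (f S : Module.End K V)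
    (hspan : Submodule.span K (⋃ α : K, genEigSet f α) = ⊤)
    (hS : ∀ (α : K), ∀ v ∈ genEigSet f α, S v = α • v)
    (g : Module.End K V) (c : K) (h : f * g - g * f = c • g) :
    (f - S) * g = g * (f - S) := by
  refine LinearMap.ext_on hspan fun v hv => ?_
  obtain ⟨α, hα⟩ := Set.mem_iUnion.1 hv
  have hfg : f (g v) - g (f v) = c • g v := LinearMap.congr_fun h v
  simp only [Module.End.mul_apply, LinearMap.sub_apply, map_sub, hS α v hα,
    hS _ _ (map_mem_genEigSet_add h hα), map_smul, add_smul, ← hfg]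
  abel
end

section
/- Let R be a ring and E an R-module. Let M ⊆ E be a submodule such that M and the quotient E/M are both simple R-modules, and assume the extension is non-split, i.e. there is no submodule N of E with M ∩ N = 0 and M + N = E. Let Q : E → E be an R-linear endomorphism with Q ≠ 0 and M ⊆ ker Q. Then the image of Q equals M, and consequently M is isomorphic to E/M as an R-module. -/
/-- Let `M ⊆ E` be a submodule with `M` and `E/M` simple, such that the extension
`0 → M → E → E/M → 0` is non-split. If `Q : E → E` is a nonzero module endomorphism
with `M ⊆ ker Q`, then `range Q = M`; consequently `M ≅ E/M`. -/
theorem stmt_3 {R E : Type*} [Ring R] [AddCommGroup E] [Module R E]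
    (M : Submodule R E)
    (hM : IsSimpleModule R M) (hQuot : IsSimpleModule R (E ⧸ M))
    (hnonsplit : ¬ ∃ N : Submodule R E, M ⊓ N = ⊥ ∧ M ⊔ N = ⊤)
    (Q : E →ₗ[R] E) (hQ : Q ≠ 0) (hker : M ≤ LinearMap.ker Q) :
    LinearMap.range Q = M ∧ Nonempty (M ≃ₗ[R] (E ⧸ M)) := by
  have hMatom : IsAtom M := isSimpleModule_iff_isAtom.mp hM
  have hMcoatom : IsCoatom M := isSimpleModule_iff_isCoatom.mp hQuot
  have hker_eq : LinearMap.ker Q = M :=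
    (hMcoatom.le_iff.mp hker).resolve_left fun h => hQ (LinearMap.ker_eq_top.mp h)
  let e : (E ⧸ M) ≃ₗ[R] LinearMap.range Q :=
    (Submodule.quotEquivOfEq _ _ hker_eq.symm).trans Q.quotKerEquivRange
  have hRatom : IsAtom (LinearMap.range Q) :=
    isSimpleModule_iff_isAtom.mp (IsSimpleModule.congr e.symm)
  have hrange : LinearMap.range Q = M := by
    by_contra hne
    have hdisj : M ⊓ LinearMap.range Q = ⊥ := (hMatom.disjoint_of_ne hRatom (Ne.symm hne)).eq_bot
    rcases hMcoatom.le_iff.mp (le_sup_left : M ≤ M ⊔ LinearMap.range Q) with h | h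
    · exact hnonsplit ⟨_, hdisj, h⟩
    · exact hRatom.1 ((inf_eq_right.mpr (sup_eq_left.mp h)).symm.trans hdisj)
  exact ⟨hrange, ⟨(e.trans (LinearEquiv.ofEq _ _ hrange)).symm⟩⟩
end

section
/- Let m ≥ 3 be an integer. For ℓ ∈ ℤ and r ∈ ℂ set h(ℓ, r) = (ℓ² + |ℓ|·m)/(2m) + r²·(m−1)/(2m). Then the two conditions 'h(ℓ−1, r−1) − h(ℓ, r) is a positive integer' and 'h(ℓ+1, r+1) − h(ℓ, r) is a nonnegative integer' hold simultaneously if and only if either ℓ ≥ 0 and r = −(ℓ+m)/(m−1), or ℓ ≤ 0 and r = −ℓ/(m−1). In particular, for ℓ ≠ 0 the value of r satisfying both conditions is unique. -/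
/-- The conformal weight `h(ℓ, r) = (ℓ² + |ℓ|·m)/(2m) + r²·(m−1)/(2m)`. -/
noncomputable def hWt (m ℓ : ℤ) (r : ℂ) : ℂ :=
  (((ℓ : ℂ)) ^ 2 + ((|ℓ| : ℤ) : ℂ) * (m : ℂ)) / (2 * (m : ℂ))
    + r ^ 2 * ((m : ℂ) - 1) / (2 * (m : ℂ))

/-- The two integrality conditions:
`h(ℓ−1, r−1) − h(ℓ, r)` is a positive integer and
`h(ℓ+1, r+1) − h(ℓ, r)` is a nonnegative integer. -/
def hCond (m ℓ : ℤ) (r : ℂ) : Prop :=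
  (∃ n : ℤ, 0 < n ∧ hWt m (ℓ - 1) (r - 1) - hWt m ℓ r = (n : ℂ)) ∧
  (∃ n : ℤ, 0 ≤ n ∧ hWt m (ℓ + 1) (r + 1) - hWt m ℓ r = (n : ℂ))

section Differences

variable {m ℓ : ℤ} {r : ℂ}

lemma hWt_sub_one_sub_of_pos (hm : m ≠ 0) (hℓ : 0 < ℓ) :
    hWt m (ℓ - 1) (r - 1) - hWt m ℓ r = -((ℓ + r * (m - 1)) / m) := by
  have hm' : (m : ℂ) ≠ 0 := by exact_mod_cast hm
  rw [hWt, hWt, abs_of_nonneg (by omega : 0 ≤ ℓ - 1), abs_of_pos hℓ]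
  push_cast
  field_simp
  ring

lemma hWt_sub_one_sub_of_nonpos (hm : m ≠ 0) (hℓ : ℓ ≤ 0) :
    hWt m (ℓ - 1) (r - 1) - hWt m ℓ r = 1 - (ℓ + r * (m - 1)) / m := by
  have hm' : (m : ℂ) ≠ 0 := by exact_mod_cast hm
  rw [hWt, hWt, abs_of_nonpos (by omega : ℓ - 1 ≤ 0), abs_of_nonpos hℓ]
  push_cast
  field_simp
  ring

lemma hWt_add_one_sub_of_nonneg (hm : m ≠ 0) (hℓ : 0 ≤ ℓ) :
    hWt m (ℓ + 1) (r + 1) - hWt m ℓ r = 1 + (ℓ + r * (m - 1)) / m := by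
  have hm' : (m : ℂ) ≠ 0 := by exact_mod_cast hm
  rw [hWt, hWt, abs_of_nonneg (by omega : 0 ≤ ℓ + 1), abs_of_nonneg hℓ]
  push_cast
  field_simp
  ring

lemma hWt_add_one_sub_of_neg (hm : m ≠ 0) (hℓ : ℓ < 0) :
    hWt m (ℓ + 1) (r + 1) - hWt m ℓ r = (ℓ + r * (m - 1)) / m := by
  have hm' : (m : ℂ) ≠ 0 := by exact_mod_cast hm
  rw [hWt, hWt, abs_of_nonpos (by omega : ℓ + 1 ≤ 0), abs_of_neg hℓ]
  push_cast
  field_simp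
  ring

lemma hCond_iff_of_pos (hm : m ≠ 0) (hℓ : 0 < ℓ) :
    hCond m ℓ r ↔ (ℓ + r * (m - 1)) / m = (-1 : ℂ) := by
  rw [hCond, hWt_sub_one_sub_of_pos hm hℓ, hWt_add_one_sub_of_nonneg hm hℓ.le]
  generalize ((ℓ : ℂ) + r * (m - 1)) / m = x
  constructor
  · rintro ⟨⟨n, hn, h⟩, k, hk, h'⟩
    have hsum : n + k = 1 := by
      exact_mod_cast (by linear_combination -h - h' : (n : ℂ) + k = 1)
    obtain rfl : k = 0 := by omega
    push_cast at h'
    linear_combination h'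
  · rintro rfl
    exact ⟨⟨1, one_pos, by norm_num⟩, 0, le_rfl, by norm_num⟩

lemma hCond_iff_of_neg (hm : m ≠ 0) (hℓ : ℓ < 0) :
    hCond m ℓ r ↔ (ℓ + r * (m - 1)) / m = (0 : ℂ) := by
  rw [hCond, hWt_sub_one_sub_of_nonpos hm hℓ.le, hWt_add_one_sub_of_neg hm hℓ]
  generalize ((ℓ : ℂ) + r * (m - 1)) / m = x
  constructor
  · rintro ⟨⟨n, hn, h⟩, k, hk, h'⟩
    have hsum : n + k = 1 := by
      exact_mod_cast (by linear_combination -h - h' : (n : ℂ) + k = 1)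
    obtain rfl : k = 0 := by omega
    simpa using h'
  · rintro rfl
    exact ⟨⟨1, one_pos, by norm_num⟩, 0, le_rfl, by norm_num⟩

lemma hCond_zero_iff (hm : m ≠ 0) :
    hCond m 0 r ↔ (((0 : ℤ) : ℂ) + r * (m - 1)) / m = -1 ∨
      (((0 : ℤ) : ℂ) + r * (m - 1)) / m = 0 := by
  rw [hCond, hWt_sub_one_sub_of_nonpos hm le_rfl, hWt_add_one_sub_of_nonneg hm le_rfl]
  generalize (((0 : ℤ) : ℂ) + r * (m - 1)) / m = x
  constructor
  · rintro ⟨⟨n, hn, h⟩, k, hk, h'⟩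
    have hsum : n + k = 2 := by
      exact_mod_cast (by linear_combination -h - h' : (n : ℂ) + k = 2)
    obtain rfl | rfl : k = 0 ∨ k = 1 := by omega
    · left
      push_cast at h'
      linear_combination h'
    · right
      push_cast at h'
      linear_combination h'
  · rintro (rfl | rfl)
    · exact ⟨⟨2, two_pos, by norm_num⟩, 0, le_rfl, by norm_num⟩
    · exact ⟨⟨1, one_pos, by norm_num⟩, 1, zero_le_one, by norm_num⟩

lemma hCond_iff (hm : m ≠ 0) :
    hCond m ℓ r ↔ (0 ≤ ℓ ∧ (ℓ + r * (m - 1)) / m = (-1 : ℂ)) ∨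
      (ℓ ≤ 0 ∧ (ℓ + r * (m - 1)) / m = (0 : ℂ)) := by
  rcases lt_trichotomy ℓ 0 with hℓ | rfl | hℓ
  · simp only [hCond_iff_of_neg hm hℓ, hℓ.not_ge, hℓ.le, false_and, true_and, false_or]
  · simp only [hCond_zero_iff hm, le_refl, true_and]
  · simp only [hCond_iff_of_pos hm hℓ, hℓ.not_ge, hℓ.le, false_and, true_and, or_false]

end Differences

lemma add_mul_div_eq_iff {K : Type*} [Field K] {a b c r t : K} (hb : b ≠ 0) (hc : c ≠ 0) :
    (a + r * b) / c = t ↔ r = -((a - t * c) / b) := by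
  rw [div_eq_iff hc, ← neg_div, eq_div_iff hb]
  constructor <;> intro h <;> linear_combination h

/-- For `m ≥ 3`, the conditions hold iff `ℓ ≥ 0` and `r = −(ℓ+m)/(m−1)`, or
`ℓ ≤ 0` and `r = −ℓ/(m−1)`; in particular, for `ℓ ≠ 0` the solution `r` is unique. -/
theorem stmt_4 (m : ℤ) (hm : 3 ≤ m) :
    (∀ (ℓ : ℤ) (r : ℂ),
      hCond m ℓ r ↔
        ((0 ≤ ℓ ∧ r = -(((ℓ : ℂ) + (m : ℂ)) / ((m : ℂ) - 1))) ∨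
         (ℓ ≤ 0 ∧ r = -((ℓ : ℂ) / ((m : ℂ) - 1))))) ∧
    (∀ ℓ : ℤ, ℓ ≠ 0 → ∀ r r' : ℂ, hCond m ℓ r → hCond m ℓ r' → r = r') := by
  have hm₀ : m ≠ 0 := by omega
  have hmC : (m : ℂ) ≠ 0 := by exact_mod_cast hm₀
  have hm₁ : (m : ℂ) - 1 ≠ 0 := by exact_mod_cast (by omega : m - 1 ≠ 0)
  have key (ℓ : ℤ) (r : ℂ) : hCond m ℓ r ↔
      ((0 ≤ ℓ ∧ r = -(((ℓ : ℂ) + (m : ℂ)) / ((m : ℂ) - 1))) ∨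
       (ℓ ≤ 0 ∧ r = -((ℓ : ℂ) / ((m : ℂ) - 1)))) := by
    rw [hCond_iff hm₀, add_mul_div_eq_iff hm₁ hmC, add_mul_div_eq_iff hm₁ hmC, neg_one_mul,
      sub_neg_eq_add, zero_mul, sub_zero]
  refine ⟨key, fun ℓ hℓ r r' h h' => ?_⟩
  rw [key] at h h'
  rcases h with ⟨h₁, rfl⟩ | ⟨h₁, rfl⟩ <;> rcases h' with ⟨h₂, rfl⟩ | ⟨h₂, rfl⟩
  · rfl
  · exact absurd (le_antisymm h₂ h₁) hℓ
  · exact absurd (le_antisymm h₁ h₂) hℓ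
  · rfl
end
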